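/- arXiv:2605.08818 — 4 statements merged into one kernel-verified Lean document; each statement's English description precedes it below -/
import Mathlib

section
/- Let n, m ≥ 1, α ∈ (0,1), β ≥ 0. There exists a constant C > 0 depending only on n, m, α, β such that for every smooth function f on (ℝⁿ \ {0}) × ℝᵐ and every point (x,y) with x ≠ 0, Γ₂(f) ≥ (3/4) a² |D_x² f|² + a b |D_{xy}² f|² + (3/4) b² |D_y² f|² − (C / |x|^{2−2α}) Γ(f), where a = |x|^{2α}, b = |x|^{2β}, |D_x² f|² = Σ_{1≤i,j≤n} (∂_{x_i}∂_{x_j} f)², |D_y² f|² = Σ_{1≤μ,ν≤m} (∂_{y_μ}∂_{y_ν} f)², and |D_{xy}² f|² = Σ_{i,μ} (∂_{x_i}∂_{y_μ} f)². -/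
open MeasureTheory

/-- Directional (partial) derivative of `f` at `ξ` in direction `v`. -/
noncomputable def pderiv' {n m : ℕ}
    (v : EuclideanSpace ℝ (Fin n) × EuclideanSpace ℝ (Fin m))
    (f : EuclideanSpace ℝ (Fin n) × EuclideanSpace ℝ (Fin m) → ℝ)
    (ξ : EuclideanSpace ℝ (Fin n) × EuclideanSpace ℝ (Fin m)) : ℝ :=
  fderiv ℝ f ξ v

/-- The `i`-th coordinate direction in the `x`-variables. -/
noncomputable def eX (n m : ℕ) (i : Fin n) :
    EuclideanSpace ℝ (Fin n) × EuclideanSpace ℝ (Fin m) :=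
  (EuclideanSpace.single i (1 : ℝ), 0)

/-- The `μ`-th coordinate direction in the `y`-variables. -/
noncomputable def eY (n m : ℕ) (μ : Fin m) :
    EuclideanSpace ℝ (Fin n) × EuclideanSpace ℝ (Fin m) :=
  (0, EuclideanSpace.single μ (1 : ℝ))

/-- The (non-positive) Grushin diffusion operator
`𝓛 f = |x|^{2α} Δ_x f + ∇(|x|^{2α}) · ∇_x f + |x|^{2β} Δ_y f`,
where `∇(|x|^{2α}) = 2α |x|^{2α−2} x`. -/
noncomputable def Lop (n m : ℕ) (α β : ℝ)
    (f : EuclideanSpace ℝ (Fin n) × EuclideanSpace ℝ (Fin m) → ℝ)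
    (ξ : EuclideanSpace ℝ (Fin n) × EuclideanSpace ℝ (Fin m)) : ℝ :=
  ‖ξ.1‖ ^ (2 * α) * (∑ i, pderiv' (eX n m i) (pderiv' (eX n m i) f) ξ)
    + 2 * α * ‖ξ.1‖ ^ (2 * α - 2) * (∑ i, ξ.1 i * pderiv' (eX n m i) f ξ)
    + ‖ξ.1‖ ^ (2 * β) * (∑ μ, pderiv' (eY n m μ) (pderiv' (eY n m μ) f) ξ)

/-- The carré du champ `Γ(f,g) = ½(𝓛(fg) − f 𝓛g − g 𝓛f)`. -/
noncomputable def carre (n m : ℕ) (α β : ℝ)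
    (f g : EuclideanSpace ℝ (Fin n) × EuclideanSpace ℝ (Fin m) → ℝ)
    (ξ : EuclideanSpace ℝ (Fin n) × EuclideanSpace ℝ (Fin m)) : ℝ :=
  (Lop n m α β (fun η => f η * g η) ξ - f ξ * Lop n m α β g ξ
    - g ξ * Lop n m α β f ξ) / 2

/-- The second carré du champ `Γ₂(f) = ½(𝓛 Γ(f) − 2 Γ(f, 𝓛f))`. -/
noncomputable def carre2 (n m : ℕ) (α β : ℝ)
    (f : EuclideanSpace ℝ (Fin n) × EuclideanSpace ℝ (Fin m) → ℝ)
    (ξ : EuclideanSpace ℝ (Fin n) × EuclideanSpace ℝ (Fin m)) : ℝ :=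
  (Lop n m α β (carre n m α β f f) ξ - 2 * carre n m α β f (Lop n m α β f) ξ) / 2

open scoped ContDiff

section DiffusionOperator

variable {E : Type*} [NormedAddCommGroup E] [NormedSpace ℝ E]

/-- The derivative of `f` in the direction `v`. -/
noncomputable def dirDeriv (v : E) (f : E → ℝ) (x : E) : ℝ := fderiv ℝ f x v

variable {U : Set E} {f g : E → ℝ} {x : E}

theorem ContDiffOn.differentiableAt_of_isOpen (hf : ContDiffOn ℝ ∞ f U) (hU : IsOpen U)
    (hx : x ∈ U) : DifferentiableAt ℝ f x :=
  (hf.contDiffAt (hU.mem_nhds hx)).differentiableAt (by simp)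

theorem ContDiffOn.dirDeriv (hf : ContDiffOn ℝ ∞ f U) (hU : IsOpen U) (v : E) :
    ContDiffOn ℝ ∞ (dirDeriv v f) U :=
  (hf.fderiv_of_isOpen hU (by simp)).clm_apply contDiffOn_const

theorem Set.EqOn.dirDeriv (h : Set.EqOn f g U) (hU : IsOpen U) (v : E) :
    Set.EqOn (dirDeriv v f) (dirDeriv v g) U := fun x hx => by
  have : f =ᶠ[nhds x] g := Filter.eventuallyEq_of_mem (hU.mem_nhds hx) h
  simp only [_root_.dirDeriv, this.fderiv_eq]

theorem dirDeriv_mul (hU : IsOpen U) (hf : ContDiffOn ℝ ∞ f U) (hg : ContDiffOn ℝ ∞ g U)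
    (hx : x ∈ U) (v : E) :
    dirDeriv v (fun y => f y * g y) x = f x * dirDeriv v g x + g x * dirDeriv v f x := by
  simp [dirDeriv, fderiv_fun_mul (hf.differentiableAt_of_isOpen hU hx)
    (hg.differentiableAt_of_isOpen hU hx)]

theorem dirDeriv_add (hU : IsOpen U) (hf : ContDiffOn ℝ ∞ f U) (hg : ContDiffOn ℝ ∞ g U)
    (hx : x ∈ U) (v : E) :
    dirDeriv v (fun y => f y + g y) x = dirDeriv v f x + dirDeriv v g x := by
  simp [dirDeriv, fderiv_fun_add (hf.differentiableAt_of_isOpen hU hx)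
    (hg.differentiableAt_of_isOpen hU hx)]

theorem dirDeriv_sum {κ : Type*} [Fintype κ] {F : κ → E → ℝ} (hU : IsOpen U)
    (hF : ∀ k, ContDiffOn ℝ ∞ (F k) U) (hx : x ∈ U) (v : E) :
    dirDeriv v (fun y => ∑ k, F k y) x = ∑ k, dirDeriv v (F k) x := by
  simp [dirDeriv, fderiv_fun_sum fun k _ => (hF k).differentiableAt_of_isOpen hU hx]

theorem dirDeriv_comm (hU : IsOpen U) (hf : ContDiffOn ℝ ∞ f U) (hx : x ∈ U) (v w : E) :
    dirDeriv v (dirDeriv w f) x = dirDeriv w (dirDeriv v f) x := by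
  have hd : DifferentiableAt ℝ (fderiv ℝ f) x :=
    ((hf.fderiv_of_isOpen hU (m := ∞) (by simp)).contDiffAt (hU.mem_nhds hx)).differentiableAt
      (by simp)
  have hs : IsSymmSndFDerivAt ℝ f x :=
    (hf.contDiffAt (hU.mem_nhds hx)).isSymmSndFDerivAt
      (by simpa [minSmoothness] using WithTop.coe_le_coe.2 (le_top : (2 : ℕ∞) ≤ ⊤))
  have key (u u' : E) : dirDeriv u (dirDeriv u' f) x = fderiv ℝ (fderiv ℝ f) x u u' := by
    change fderiv ℝ (fun y => fderiv ℝ f y u') x u = _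
    rw [fderiv_clm_apply hd (differentiableAt_const _)]
    simp
  rw [key, key, hs.eq]

variable {ι : Type*} [Fintype ι] (e : ι → E) (c d : ι → E → ℝ)

/-- The second order operator `∑ k, (c k * ∂ₖ² + d k * ∂ₖ)`, with `∂ₖ` the derivative in the
direction `e k`. -/
noncomputable def diffusionOp (f : E → ℝ) (x : E) : ℝ :=
  ∑ k, (c k x * dirDeriv (e k) (dirDeriv (e k) f) x + d k x * dirDeriv (e k) f x)

theorem Set.EqOn.diffusionOp (h : Set.EqOn f g U) (hU : IsOpen U) :
    Set.EqOn (diffusionOp e c d f) (diffusionOp e c d g) U := fun x hx => by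
  simp only [_root_.diffusionOp, (h.dirDeriv hU _) hx, ((h.dirDeriv hU _).dirDeriv hU _) hx]

theorem diffusionOp_mul (hU : IsOpen U) (hf : ContDiffOn ℝ ∞ f U) (hg : ContDiffOn ℝ ∞ g U)
    (hx : x ∈ U) :
    diffusionOp e c d (fun y => f y * g y) x = f x * diffusionOp e c d g x
      + g x * diffusionOp e c d f x
      + 2 * ∑ k, c k x * (dirDeriv (e k) f x * dirDeriv (e k) g x) := by
  simp only [diffusionOp, Finset.mul_sum, ← Finset.sum_add_distrib]
  refine Finset.sum_congr rfl fun k _ => ?_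
  have h1 : Set.EqOn (dirDeriv (e k) fun y => f y * g y)
      (fun y => f y * dirDeriv (e k) g y + g y * dirDeriv (e k) f y) U :=
    fun y hy => dirDeriv_mul hU hf hg hy _
  have hf' := hf.dirDeriv hU (e k)
  have hg' := hg.dirDeriv hU (e k)
  rw [h1.dirDeriv hU _ hx, h1 hx, dirDeriv_add hU (hf.mul hg') (hg.mul hf') hx,
    dirDeriv_mul hU hf hg' hx, dirDeriv_mul hU hg hf' hx]
  ring

theorem diffusionOp_sum {κ : Type*} [Fintype κ] {F : κ → E → ℝ} (hU : IsOpen U)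
    (hF : ∀ l, ContDiffOn ℝ ∞ (F l) U) (hx : x ∈ U) :
    diffusionOp e c d (fun y => ∑ l, F l y) x = ∑ l, diffusionOp e c d (F l) x := by
  have h1 (k : ι) : Set.EqOn (dirDeriv (e k) fun y => ∑ l, F l y)
      (fun y => ∑ l, dirDeriv (e k) (F l) y) U := fun y hy => dirDeriv_sum hU hF hy _
  simp only [diffusionOp]
  rw [Finset.sum_comm]
  refine Finset.sum_congr rfl fun k _ => ?_
  rw [(h1 k).dirDeriv hU _ hx, h1 k hx, dirDeriv_sum hU (fun l => (hF l).dirDeriv hU _) hx,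
    Finset.mul_sum, Finset.mul_sum, Finset.sum_add_distrib]

variable {e c d}

theorem ContDiffOn.diffusionOp (hU : IsOpen U) (hc : ∀ k, ContDiffOn ℝ ∞ (c k) U)
    (hd : ∀ k, ContDiffOn ℝ ∞ (d k) U) (hf : ContDiffOn ℝ ∞ f U) :
    ContDiffOn ℝ ∞ (diffusionOp e c d f) U :=
  ContDiffOn.sum fun k _ => ((hc k).mul ((hf.dirDeriv hU _).dirDeriv hU _)).add
    ((hd k).mul (hf.dirDeriv hU _))

theorem dirDeriv_diffusionOp (hU : IsOpen U) (hc : ∀ k, ContDiffOn ℝ ∞ (c k) U)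
    (hd : ∀ k, ContDiffOn ℝ ∞ (d k) U) (hf : ContDiffOn ℝ ∞ f U) (hx : x ∈ U) (v : E) :
    dirDeriv v (diffusionOp e c d f) x = diffusionOp e c d (dirDeriv v f) x
      + ∑ k, (dirDeriv v (c k) x * dirDeriv (e k) (dirDeriv (e k) f) x
        + dirDeriv v (d k) x * dirDeriv (e k) f x) := by
  have hf1 (k : ι) := hf.dirDeriv hU (e k)
  have hf2 (k : ι) := (hf1 k).dirDeriv hU (e k)
  have h1 (k : ι) : Set.EqOn (dirDeriv v (dirDeriv (e k) f)) (dirDeriv (e k) (dirDeriv v f)) U :=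
    fun y hy => dirDeriv_comm hU hf hy _ _
  change dirDeriv v (fun y => ∑ k, _) x = _
  rw [dirDeriv_sum hU (fun k => ((hc k).mul (hf2 k)).add ((hd k).mul (hf1 k))) hx]
  simp only [diffusionOp, ← Finset.sum_add_distrib]
  refine Finset.sum_congr rfl fun k _ => ?_
  rw [dirDeriv_add hU ((hc k).mul (hf2 k)) ((hd k).mul (hf1 k)) hx,
    dirDeriv_mul hU (hc k) (hf2 k) hx, dirDeriv_mul hU (hd k) (hf1 k) hx,
    dirDeriv_comm hU (hf1 k) hx, (h1 k).dirDeriv hU _ hx, h1 k hx]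
  ring

/-- Bochner's formula for the second carré du champ of a diagonal diffusion operator. -/
theorem diffusionOp_bochner (hU : IsOpen U) (hc : ∀ k, ContDiffOn ℝ ∞ (c k) U)
    (hd : ∀ k, ContDiffOn ℝ ∞ (d k) U) (hf : ContDiffOn ℝ ∞ f U) (hx : x ∈ U) :
    diffusionOp e c d (fun y => ∑ l, c l y * (dirDeriv (e l) f y * dirDeriv (e l) f y)) x
      - 2 * ∑ l, c l x * (dirDeriv (e l) f x * dirDeriv (e l) (diffusionOp e c d f) x)
    = ∑ l, (dirDeriv (e l) f x ^ 2 * diffusionOp e c d (c l) x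
        + ∑ k, (2 * (c l x * c k x * dirDeriv (e k) (dirDeriv (e l) f) x ^ 2)
        + 4 * (dirDeriv (e l) f x * c k x * dirDeriv (e k) (c l) x
            * dirDeriv (e k) (dirDeriv (e l) f) x)
        - 2 * (c l x * dirDeriv (e l) f x * dirDeriv (e l) (c k) x
            * dirDeriv (e k) (dirDeriv (e k) f) x)
        - 2 * (c l x * dirDeriv (e l) f x * dirDeriv (e l) (d k) x * dirDeriv (e k) f x))) := by
  have hf1 (l : ι) := hf.dirDeriv hU (e l)
  rw [diffusionOp_sum e c d hU (fun l => (hc l).mul ((hf1 l).mul (hf1 l))) hx, Finset.mul_sum,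
    ← Finset.sum_sub_distrib]
  refine Finset.sum_congr rfl fun l _ => ?_
  rw [diffusionOp_mul e c d hU (hc l) ((hf1 l).mul (hf1 l)) hx,
    diffusionOp_mul e c d hU (hf1 l) (hf1 l) hx, dirDeriv_diffusionOp hU hc hd hf hx]
  simp only [dirDeriv_mul hU (hf1 l) (hf1 l) hx, Finset.mul_sum, mul_add]
  rw [← sub_eq_zero]
  have key (A A' B C' D F G H I : ℝ) (h : A + A' + B - F - I = 0) (h' : C' + D - G - H = 0) :
      A + A' + C' + B + D - (F + G) - (I + H) = 0 := by linarith
  refine key _ _ _ _ _ _ _ _ _ (by ring) ?_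
  simp only [← Finset.sum_add_distrib, ← Finset.sum_sub_distrib]
  exact Finset.sum_eq_zero fun k _ => by ring

end DiffusionOperator

theorem carre2_sums_lower_bound {n m : ℕ} {α β : ℝ} (hα : 0 < α) (hα' : α < 1)
    {r h b k : ℝ} (hh : 0 < h) (hb : 0 < b) (hk : k * r ^ 2 = 1) (hk0 : 0 < k)
    (x p : Fin n → ℝ) (q : Fin m → ℝ) (H : Fin n → Fin n → ℝ) (M : Fin n → Fin m → ℝ)
    (N : Fin m → Fin m → ℝ) (hx : ∑ i, x i ^ 2 = r ^ 2) :
    3 / 4 * (h * r ^ 2) ^ 2 * (∑ i, ∑ j, H i j ^ 2) + h * r ^ 2 * b * (∑ i, ∑ μ, M i μ ^ 2)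
      + 3 / 4 * b ^ 2 * (∑ μ, ∑ ν, N μ ν ^ 2)
      - (1 + |α * (4 * α - 2 + n)| + 2 * α + 32 * α ^ 2 + 8 * n * α ^ 2 + 4 * m * β ^ 2
          + |β * (2 * β - 2 + n + 2 * α)| + 4 * β ^ 2) * h
        * (h * r ^ 2 * ∑ i, p i ^ 2 + b * ∑ μ, q μ ^ 2)
    ≤ (h * r ^ 2) ^ 2 * (∑ i, ∑ j, H i j ^ 2) + 2 * (h * r ^ 2 * b) * (∑ i, ∑ μ, M i μ ^ 2)
      + b ^ 2 * (∑ μ, ∑ ν, N μ ν ^ 2)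
      + α * (4 * α - 2 + n) * h * (h * r ^ 2) * (∑ i, p i ^ 2)
      + β * (2 * β - 2 + n + 2 * α) * h * b * (∑ μ, q μ ^ 2)
      + 4 * α * h * (h * r ^ 2) * (∑ i, ∑ j, x i * p j * H i j)
      - 2 * α * h * (h * r ^ 2) * (∑ i, x i * p i) * (∑ j, H j j)
      - 2 * α * (2 * α - 2) * h ^ 2 * (∑ i, x i * p i) ^ 2
      - 2 * α * h * (h * r ^ 2) * (∑ i, p i ^ 2)
      - 2 * β * h * b * (∑ i, x i * p i) * (∑ μ, N μ μ)
      + 4 * β * h * b * (∑ i, ∑ μ, x i * q μ * M i μ) := by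
  have hP : 0 ≤ ∑ i, p i ^ 2 := Finset.sum_nonneg fun _ _ => sq_nonneg _
  have hQ : 0 ≤ ∑ μ, q μ ^ 2 := Finset.sum_nonneg fun _ _ => sq_nonneg _
  have hs : (∑ i, x i * p i) ^ 2 ≤ r ^ 2 * ∑ i, p i ^ 2 :=
    hx ▸ Finset.sum_mul_sq_le_sq_mul_sq _ _ _
  have hr : 0 ≤ r ^ 2 := sq_nonneg r
  have h1 : -(1 / 8 * (h * r ^ 2) ^ 2 * (∑ i, ∑ j, H i j ^ 2)
        + 32 * α ^ 2 * h ^ 2 * (r ^ 2 * ∑ i, p i ^ 2))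
      ≤ 4 * α * h * (h * r ^ 2) * (∑ i, ∑ j, x i * p j * H i j) := by
    rw [← hx, Finset.sum_mul_sum, hx, neg_le_iff_add_nonneg]
    simp only [Finset.mul_sum, ← Finset.sum_add_distrib]
    refine Finset.sum_nonneg fun i _ => Finset.sum_nonneg fun j _ => ?_
    nlinarith [sq_nonneg (h * r ^ 2 * H i j + 16 * α * h * (x i * p j))]
  have hdiag {l : ℕ} (F : Fin l → Fin l → ℝ) : ∑ j, F j j ^ 2 ≤ ∑ i, ∑ j, F i j ^ 2 :=
    Finset.sum_le_sum fun i _ =>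
      Finset.single_le_sum (f := fun j => F i j ^ 2) (fun _ _ => sq_nonneg _) (Finset.mem_univ i)
  generalize hS : (∑ i, x i * p i) = s at *
  have h2 : -(1 / 8 * (h * r ^ 2) ^ 2 * (∑ i, ∑ j, H i j ^ 2) + 8 * n * α ^ 2 * h ^ 2 * s ^ 2)
      ≤ -(2 * α * h * (h * r ^ 2) * s * (∑ j, H j j)) := by
    have : 0 ≤ ∑ j, (1 / 8 * (h * r ^ 2) ^ 2 * H j j ^ 2 + 8 * α ^ 2 * h ^ 2 * s ^ 2
        - 2 * α * h * (h * r ^ 2) * s * H j j) :=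
      Finset.sum_nonneg fun j _ => by nlinarith [sq_nonneg (h * r ^ 2 * H j j - 8 * α * h * s)]
    simp only [Finset.sum_add_distrib, Finset.sum_sub_distrib, ← Finset.mul_sum, Finset.sum_const,
      Finset.card_univ, Fintype.card_fin, nsmul_eq_mul] at this
    have := mul_le_mul_of_nonneg_left (hdiag H) (by positivity : 0 ≤ 1 / 8 * (h * r ^ 2) ^ 2)
    linarith
  have h3 : -(1 / 4 * b ^ 2 * (∑ μ, ∑ ν, N μ ν ^ 2) + 4 * m * β ^ 2 * h ^ 2 * s ^ 2)
      ≤ -(2 * β * h * b * s * (∑ μ, N μ μ)) := by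
    have : 0 ≤ ∑ j, (1 / 4 * b ^ 2 * N j j ^ 2 + 4 * β ^ 2 * h ^ 2 * s ^ 2
        - 2 * β * h * b * s * N j j) :=
      Finset.sum_nonneg fun j _ => by nlinarith [sq_nonneg (b * N j j - 4 * β * h * s)]
    simp only [Finset.sum_add_distrib, Finset.sum_sub_distrib, ← Finset.mul_sum, Finset.sum_const,
      Finset.card_univ, Fintype.card_fin, nsmul_eq_mul] at this
    have := mul_le_mul_of_nonneg_left (hdiag N) (by positivity : 0 ≤ 1 / 4 * b ^ 2)
    linarith
  have h4 : -(h * r ^ 2 * b * (∑ i, ∑ μ, M i μ ^ 2) + 4 * β ^ 2 * h * b * (∑ μ, q μ ^ 2))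
      ≤ 4 * β * h * b * (∑ i, ∑ μ, x i * q μ * M i μ) := by
    have e : 4 * β ^ 2 * h * b * (∑ μ, q μ ^ 2)
        = 4 * β ^ 2 * h * b * k * ∑ i, ∑ μ, x i ^ 2 * q μ ^ 2 := by
      rw [← Finset.sum_mul_sum, hx]
      linear_combination -(4 * β ^ 2 * h * b * (∑ μ, q μ ^ 2)) * hk
    rw [e, neg_le_iff_add_nonneg]
    simp only [Finset.mul_sum, ← Finset.sum_add_distrib]
    refine Finset.sum_nonneg fun i _ => Finset.sum_nonneg fun j _ => ?_
    have : 0 ≤ h * b * k * (r ^ 2 * M i j + 2 * β * (x i * q j)) ^ 2 := by positivity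
    refine this.trans_eq ?_
    linear_combination (h * b * r ^ 2 * M i j ^ 2 + 4 * β * h * b * x i * q j * M i j) * hk
  have h5 : 0 ≤ -(2 * α * (2 * α - 2) * h ^ 2 * s ^ 2) := by
    have : 0 ≤ 4 * α * (1 - α) * h ^ 2 * s ^ 2 := by
      have : 0 < 1 - α := by linarith
      positivity
    linarith
  have h6 : 8 * n * α ^ 2 * h ^ 2 * s ^ 2 ≤ 8 * n * α ^ 2 * h ^ 2 * (r ^ 2 * ∑ i, p i ^ 2) := by
    gcongr
  have h7 : 4 * m * β ^ 2 * h ^ 2 * s ^ 2 ≤ 4 * m * β ^ 2 * h ^ 2 * (r ^ 2 * ∑ i, p i ^ 2) := by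
    gcongr
  have hP' : 0 ≤ h * (h * r ^ 2) * ∑ i, p i ^ 2 := by positivity
  have hQ' : 0 ≤ h * b * ∑ μ, q μ ^ 2 := by positivity
  have h8 := mul_le_mul_of_nonneg_right (neg_abs_le (α * (4 * α - 2 + n))) hP'
  have h9 := mul_le_mul_of_nonneg_right (neg_abs_le (β * (2 * β - 2 + n + 2 * α))) hQ'
  have h10 : 0 ≤ (1 + |β * (2 * β - 2 + n + 2 * α)| + 4 * β ^ 2)
      * (h * (h * r ^ 2) * ∑ i, p i ^ 2) := by positivity
  have h11 : 0 ≤ (1 + |α * (4 * α - 2 + n)| + 2 * α + 32 * α ^ 2 + 8 * n * α ^ 2 + 4 * m * β ^ 2)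
      * (h * b * ∑ μ, q μ ^ 2) := by positivity
  linarith

section Grushin

variable {n m : ℕ}

theorem isOpen_fst_ne_zero :
    IsOpen {ξ : EuclideanSpace ℝ (Fin n) × EuclideanSpace ℝ (Fin m) | ξ.1 ≠ 0} :=
  isOpen_compl_singleton.preimage continuous_fst

theorem hasFDerivAt_norm_fst_rpow (p : ℝ)
    {ξ : EuclideanSpace ℝ (Fin n) × EuclideanSpace ℝ (Fin m)} (hξ : ξ.1 ≠ 0) :
    HasFDerivAt
      (fun η : EuclideanSpace ℝ (Fin n) × EuclideanSpace ℝ (Fin m) => ‖η.1‖ ^ p)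
      ((p * ‖ξ.1‖ ^ (p - 2)) • (innerSL ℝ ξ.1).comp (ContinuousLinearMap.fst ℝ _ _)) ξ := by
  have h0 : 0 < ‖ξ.1‖ := norm_pos_iff.2 hξ
  have h1 := (((hasStrictFDerivAt_norm_sq ξ.1).hasFDerivAt.comp ξ hasFDerivAt_fst).rpow_const
    (p := p / 2) (Or.inl (pow_pos h0 2).ne'))
  have h2 (t q : ℝ) (ht : 0 ≤ t) : (t ^ 2) ^ q = t ^ (2 * q) := by
    rw [← Real.rpow_natCast, ← Real.rpow_mul ht]; norm_num
  refine (h1.congr_fderiv ?_).congr_of_eventuallyEq (Filter.Eventually.of_forall fun η => ?_)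
  · simp only [Function.comp, h2 _ _ h0.le]
    ext v <;> simp
    all_goals ring_nf
  · simp only [Function.comp, h2 _ _ (norm_nonneg _)]
    congr 1; ring

theorem contDiffOn_norm_fst_rpow (p : ℝ) :
    ContDiffOn ℝ ∞
      (fun η : EuclideanSpace ℝ (Fin n) × EuclideanSpace ℝ (Fin m) => ‖η.1‖ ^ p)
      {ξ | ξ.1 ≠ 0} := fun _ hξ =>
  ((contDiffAt_fst.norm ℝ hξ).rpow_const_of_ne (norm_ne_zero_iff.2 hξ)).contDiffWithinAt

theorem contDiffOn_fst_apply (i : Fin n)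
    (U : Set (EuclideanSpace ℝ (Fin n) × EuclideanSpace ℝ (Fin m))) :
    ContDiffOn ℝ ∞
      (fun η : EuclideanSpace ℝ (Fin n) × EuclideanSpace ℝ (Fin m) => η.1 i) U := by
  have : ContDiff ℝ ∞
      (fun η : EuclideanSpace ℝ (Fin n) × EuclideanSpace ℝ (Fin m) => η.1 i) := by fun_prop
  exact this.contDiffOn

theorem dirDeriv_eX_norm_rpow (p : ℝ)
    {ξ : EuclideanSpace ℝ (Fin n) × EuclideanSpace ℝ (Fin m)} (hξ : ξ.1 ≠ 0) (i : Fin n) :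
    dirDeriv (eX n m i) (fun η => ‖η.1‖ ^ p) ξ = p * ‖ξ.1‖ ^ (p - 2) * ξ.1 i := by
  simp [dirDeriv, (hasFDerivAt_norm_fst_rpow p hξ).fderiv, eX, EuclideanSpace.inner_single_right]

theorem dirDeriv_eY_norm_rpow (p : ℝ)
    {ξ : EuclideanSpace ℝ (Fin n) × EuclideanSpace ℝ (Fin m)} (hξ : ξ.1 ≠ 0) (μ : Fin m) :
    dirDeriv (eY n m μ) (fun η => ‖η.1‖ ^ p) ξ = 0 := by
  simp [dirDeriv, (hasFDerivAt_norm_fst_rpow p hξ).fderiv, eY]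

theorem dirDeriv_fst_apply (v ξ : EuclideanSpace ℝ (Fin n) × EuclideanSpace ℝ (Fin m))
    (i : Fin n) : dirDeriv v (fun η => η.1 i) ξ = v.1 i := by
  have : HasFDerivAt (fun η : EuclideanSpace ℝ (Fin n) × EuclideanSpace ℝ (Fin m) => η.1 i)
      ((EuclideanSpace.proj i).comp (ContinuousLinearMap.fst ℝ _ _)) ξ :=
    ((EuclideanSpace.proj (𝕜 := ℝ) i).comp (ContinuousLinearMap.fst ℝ (EuclideanSpace ℝ (Fin n))
      (EuclideanSpace ℝ (Fin m)))).hasFDerivAt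
  simp [dirDeriv, this.fderiv]

theorem dirDeriv_norm_rpow_mul_apply (p c : ℝ)
    {ξ : EuclideanSpace ℝ (Fin n) × EuclideanSpace ℝ (Fin m)} (hξ : ξ.1 ≠ 0) (j : Fin n)
    (v : EuclideanSpace ℝ (Fin n) × EuclideanSpace ℝ (Fin m)) :
    dirDeriv v (fun η => c * ‖η.1‖ ^ p * η.1 j) ξ =
      c * (‖ξ.1‖ ^ p * v.1 j + ξ.1 j * dirDeriv v (fun η => ‖η.1‖ ^ p) ξ) := by
  have hc : dirDeriv v (fun _ => c) ξ = 0 := by simp [dirDeriv]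
  rw [dirDeriv_mul isOpen_fst_ne_zero (contDiffOn_const.mul (contDiffOn_norm_fst_rpow p))
      (contDiffOn_fst_apply j _) hξ,
    dirDeriv_mul isOpen_fst_ne_zero contDiffOn_const (contDiffOn_norm_fst_rpow p) hξ,
    dirDeriv_fst_apply, hc]
  ring

/-- The coordinate directions of `ℝⁿ × ℝᵐ`. -/
noncomputable def grushinDir (n m : ℕ) :
    Fin n ⊕ Fin m → EuclideanSpace ℝ (Fin n) × EuclideanSpace ℝ (Fin m) :=
  Sum.elim (eX n m) (eY n m)

/-- The second order coefficients of the Grushin operator. -/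
noncomputable def grushinDiffusion (n m : ℕ) (α β : ℝ) :
    Fin n ⊕ Fin m → EuclideanSpace ℝ (Fin n) × EuclideanSpace ℝ (Fin m) → ℝ :=
  Sum.elim (fun _ ξ => ‖ξ.1‖ ^ (2 * α)) (fun _ ξ => ‖ξ.1‖ ^ (2 * β))

/-- The first order coefficients of the Grushin operator. -/
noncomputable def grushinDrift (n m : ℕ) (α : ℝ) :
    Fin n ⊕ Fin m → EuclideanSpace ℝ (Fin n) × EuclideanSpace ℝ (Fin m) → ℝ :=
  Sum.elim (fun i ξ => 2 * α * ‖ξ.1‖ ^ (2 * α - 2) * ξ.1 i) (fun _ _ => 0)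

theorem contDiffOn_grushinDiffusion (α β : ℝ) (k : Fin n ⊕ Fin m) :
    ContDiffOn ℝ ∞ (grushinDiffusion n m α β k) {ξ | ξ.1 ≠ 0} := by
  rcases k with i | μ
  · exact contDiffOn_norm_fst_rpow (2 * α)
  · exact contDiffOn_norm_fst_rpow (2 * β)

theorem contDiffOn_grushinDrift (α : ℝ) (k : Fin n ⊕ Fin m) :
    ContDiffOn ℝ ∞ (grushinDrift n m α k) {ξ | ξ.1 ≠ 0} := by
  rcases k with i | μ
  · exact (contDiffOn_const.mul (contDiffOn_norm_fst_rpow _)).mul (contDiffOn_fst_apply i _)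
  · exact contDiffOn_const

theorem Lop_eq_diffusionOp (α β : ℝ) :
    Lop n m α β = diffusionOp (grushinDir n m) (grushinDiffusion n m α β)
      (grushinDrift n m α) := by
  funext f ξ
  simp only [Lop, diffusionOp, Fintype.sum_sum_type, grushinDir, grushinDiffusion, grushinDrift,
    Sum.elim_inl, Sum.elim_inr, zero_mul, add_zero, Finset.sum_add_distrib, Finset.mul_sum,
    mul_assoc, Finset.sum_const_zero]
  rw [add_right_comm]
  rfl

theorem Lop_norm_rpow (α β p : ℝ)
    {ξ : EuclideanSpace ℝ (Fin n) × EuclideanSpace ℝ (Fin m)} (hξ : ξ.1 ≠ 0) :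
    Lop n m α β (fun η => ‖η.1‖ ^ p) ξ
      = p * (p - 2 + n + 2 * α) * ‖ξ.1‖ ^ (2 * α - 2) * ‖ξ.1‖ ^ p := by
  have h0 : 0 < ‖ξ.1‖ := norm_pos_iff.2 hξ
  have hX (i : Fin n) : Set.EqOn (dirDeriv (eX n m i) fun η => ‖η.1‖ ^ p)
      (fun η => p * ‖η.1‖ ^ (p - 2) * η.1 i) {ξ | ξ.1 ≠ 0} :=
    fun η hη => dirDeriv_eX_norm_rpow p hη i
  have hY (μ : Fin m) : Set.EqOn (dirDeriv (eY n m μ) fun η => ‖η.1‖ ^ p)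
      (fun _ => 0) {ξ | ξ.1 ≠ 0} :=
    fun η hη => dirDeriv_eY_norm_rpow p hη μ
  have hXX (i : Fin n) := (hX i).dirDeriv isOpen_fst_ne_zero (eX n m i) hξ
  have hYY (μ : Fin m) := (hY μ).dirDeriv isOpen_fst_ne_zero (eY n m μ) hξ
  have hsq : ∑ i, ξ.1 i ^ 2 = ‖ξ.1‖ ^ 2 := (EuclideanSpace.real_norm_sq_eq _).symm
  have hzero (μ : Fin m) : dirDeriv (eY n m μ) (fun _ => (0 : ℝ)) ξ = 0 := by simp [dirDeriv]
  change ‖ξ.1‖ ^ (2 * α) * (∑ i, dirDeriv (eX n m i) (dirDeriv (eX n m i) _) ξ)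
    + 2 * α * ‖ξ.1‖ ^ (2 * α - 2) * (∑ i, ξ.1 i * dirDeriv (eX n m i) _ ξ)
    + ‖ξ.1‖ ^ (2 * β) * (∑ μ, dirDeriv (eY n m μ) (dirDeriv (eY n m μ) _) ξ) = _
  simp only [hXX, hYY, hzero, hX _ hξ, dirDeriv_norm_rpow_mul_apply _ _ hξ,
    dirDeriv_eX_norm_rpow _ hξ]
  have e1 (i : Fin n) : p * (‖ξ.1‖ ^ (p - 2) * (eX n m i).1 i
      + ξ.1 i * ((p - 2) * ‖ξ.1‖ ^ (p - 2 - 2) * ξ.1 i))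
      = p * ‖ξ.1‖ ^ (p - 2) + p * (p - 2) * ‖ξ.1‖ ^ (p - 2 - 2) * ξ.1 i ^ 2 := by
    simp [eX]; ring
  have e2 (i : Fin n) : ξ.1 i * (p * ‖ξ.1‖ ^ (p - 2) * ξ.1 i)
      = p * ‖ξ.1‖ ^ (p - 2) * ξ.1 i ^ 2 := by ring
  simp only [e1, e2, Finset.sum_add_distrib, ← Finset.mul_sum, hsq, Finset.sum_const,
    Finset.card_univ, Fintype.card_fin, nsmul_eq_mul, mul_zero, add_zero]
  have r2 (t : ℝ) : ‖ξ.1‖ ^ t = ‖ξ.1‖ ^ (t - 2) * ‖ξ.1‖ ^ 2 := by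
    rw [← Real.rpow_natCast, ← Real.rpow_add h0]; norm_num
  rw [r2 (2 * α), r2 p, r2 (p - 2)]
  ring

theorem carre_eq_sum (α β : ℝ)
    {f g : EuclideanSpace ℝ (Fin n) × EuclideanSpace ℝ (Fin m) → ℝ}
    (hf : ContDiffOn ℝ ∞ f {ξ | ξ.1 ≠ 0}) (hg : ContDiffOn ℝ ∞ g {ξ | ξ.1 ≠ 0})
    {ξ : EuclideanSpace ℝ (Fin n) × EuclideanSpace ℝ (Fin m)} (hξ : ξ.1 ≠ 0) :
    carre n m α β f g ξ = ∑ k, grushinDiffusion n m α β k ξ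
      * (dirDeriv (grushinDir n m k) f ξ * dirDeriv (grushinDir n m k) g ξ) := by
  rw [carre, Lop_eq_diffusionOp, diffusionOp_mul _ _ _ isOpen_fst_ne_zero hf hg hξ]
  ring

theorem carre2_eq_sum (α β : ℝ)
    {f : EuclideanSpace ℝ (Fin n) × EuclideanSpace ℝ (Fin m) → ℝ}
    (hf : ContDiffOn ℝ ∞ f {ξ | ξ.1 ≠ 0})
    {ξ : EuclideanSpace ℝ (Fin n) × EuclideanSpace ℝ (Fin m)} (hξ : ξ.1 ≠ 0)
    {r h b : ℝ} (hr : r = ‖ξ.1‖) (hh : h = r ^ (2 * α - 2)) (hb : b = r ^ (2 * β))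
    {p : Fin n → ℝ} (hp : p = fun i => pderiv' (eX n m i) f ξ)
    {q : Fin m → ℝ} (hq : q = fun μ => pderiv' (eY n m μ) f ξ)
    {H : Fin n → Fin n → ℝ} (hH : H = fun i j => pderiv' (eX n m i) (pderiv' (eX n m j) f) ξ)
    {M : Fin n → Fin m → ℝ} (hM : M = fun i μ => pderiv' (eX n m i) (pderiv' (eY n m μ) f) ξ)
    {N : Fin m → Fin m → ℝ} (hN : N = fun μ ν => pderiv' (eY n m μ) (pderiv' (eY n m ν) f) ξ) :
    carre2 n m α β f ξ =
      (h * r ^ 2) ^ 2 * (∑ i, ∑ j, H i j ^ 2) + 2 * (h * r ^ 2 * b) * (∑ i, ∑ μ, M i μ ^ 2)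
      + b ^ 2 * (∑ μ, ∑ ν, N μ ν ^ 2)
      + α * (4 * α - 2 + n) * h * (h * r ^ 2) * (∑ i, p i ^ 2)
      + β * (2 * β - 2 + n + 2 * α) * h * b * (∑ μ, q μ ^ 2)
      + 4 * α * h * (h * r ^ 2) * (∑ i, ∑ j, ξ.1 i * p j * H i j)
      - 2 * α * h * (h * r ^ 2) * (∑ i, ξ.1 i * p i) * (∑ j, H j j)
      - 2 * α * (2 * α - 2) * h ^ 2 * (∑ i, ξ.1 i * p i) ^ 2
      - 2 * α * h * (h * r ^ 2) * (∑ i, p i ^ 2)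
      - 2 * β * h * b * (∑ i, ξ.1 i * p i) * (∑ μ, N μ μ)
      + 4 * β * h * b * (∑ i, ∑ μ, ξ.1 i * q μ * M i μ) := by
  have hU := isOpen_fst_ne_zero (n := n) (m := m)
  have hc := contDiffOn_grushinDiffusion (n := n) (m := m) α β
  have hd := contDiffOn_grushinDrift (n := n) (m := m) α
  have hL := hf.diffusionOp (e := grushinDir n m) hU hc hd
  have h0 : 0 < r := hr ▸ norm_pos_iff.2 hξ
  have hΓ : Set.EqOn (carre n m α β f f) _ {ξ | ξ.1 ≠ 0} := fun η hη => carre_eq_sum α β hf hf hη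
  have r2 (t : ℝ) : r ^ t = r ^ (t - 2) * r ^ 2 := by
    rw [← Real.rpow_natCast, ← Real.rpow_add h0]; norm_num
  have hX (i : Fin n) : dirDeriv (eX n m i) f ξ = p i := by rw [hp]; rfl
  have hY (μ : Fin m) : dirDeriv (eY n m μ) f ξ = q μ := by rw [hq]; rfl
  have hXX (i j : Fin n) : dirDeriv (eX n m i) (dirDeriv (eX n m j) f) ξ = H i j := by
    rw [hH]; rfl
  have hXY (i : Fin n) (μ : Fin m) :
      dirDeriv (eX n m i) (dirDeriv (eY n m μ) f) ξ = M i μ := by rw [hM]; rfl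
  have hYX (i : Fin n) (μ : Fin m) :
      dirDeriv (eY n m μ) (dirDeriv (eX n m i) f) ξ = M i μ := by
    rw [← hXY, dirDeriv_comm hU hf hξ]
  have hYY (μ ν : Fin m) : dirDeriv (eY n m μ) (dirDeriv (eY n m ν) f) ξ = N μ ν := by
    rw [hN]; rfl
  have hzero (v : EuclideanSpace ℝ (Fin n) × EuclideanSpace ℝ (Fin m)) :
      dirDeriv v (fun _ => (0 : ℝ)) ξ = 0 := by simp [dirDeriv]
  have hLr (t : ℝ) := Lop_norm_rpow α β t hξ
  rw [Lop_eq_diffusionOp] at hLr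
  rw [carre2, Lop_eq_diffusionOp, carre_eq_sum α β hf hL hξ,
    hΓ.diffusionOp _ _ _ hU hξ, diffusionOp_bochner hU hc hd hf hξ]
  simp only [Fintype.sum_sum_type]
  simp only [grushinDir, grushinDiffusion, grushinDrift, Sum.elim_inl, Sum.elim_inr] at hLr ⊢
  simp only [hLr, hX, hY, hXX, hXY, hYX, hYY, hzero, dirDeriv_norm_rpow_mul_apply _ _ hξ,
    dirDeriv_eX_norm_rpow _ hξ, dirDeriv_eY_norm_rpow _ hξ, ← hr]
  have e1 (i : Fin n) (j : Fin n) : (eX n m i).1 j = if j = i then 1 else 0 := by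
    simp [eX]
  have e2 (μ : Fin m) (j : Fin n) : (eY n m μ).1 j = 0 := by simp [eY]
  have ha : r ^ (2 * α) = h * r ^ 2 := hh ▸ r2 _
  have hb2 : b = r ^ (2 * β - 2) * r ^ 2 := hb ▸ r2 _
  have hh2 : h = r ^ (2 * α - 2 - 2) * r ^ 2 := hh ▸ r2 _
  simp only [e1, e2, ha, ← hh, ← hb]
  generalize r ^ (2 * β - 2) = b' at hb2
  generalize r ^ (2 * α - 2 - 2) = h' at hh2
  trans ((∑ i, (2 * α * (4 * α - 2 + n) * h * (h * r ^ 2) * p i ^ 2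
        + (∑ j, (2 * (h * r ^ 2) ^ 2 * H j i ^ 2
          + 8 * α * h * (h * r ^ 2) * (ξ.1 j * p i * H j i)
          - 4 * α * h * (h * r ^ 2) * (ξ.1 i * p i * H j j)
          - 4 * α * (2 * α - 2) * h ^ 2 * (ξ.1 i * p i * (ξ.1 j * p j))
          - if j = i then 4 * α * h * (h * r ^ 2) * p j ^ 2 else 0)
        + ∑ μ, (2 * (h * r ^ 2) * b * M i μ ^ 2 - 4 * β * h * b * (ξ.1 i * p i * N μ μ)))))
      + ∑ μ, (2 * β * (2 * β - 2 + n + 2 * α) * h * b * q μ ^ 2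
        + (∑ i, (2 * (h * r ^ 2) * b * M i μ ^ 2 + 8 * β * h * b * (ξ.1 i * q μ * M i μ))
        + ∑ ν, 2 * b ^ 2 * N ν μ ^ 2))) / 2
  · subst hb2 hh2
    congr 2
    · refine Finset.sum_congr rfl fun i _ => congrArg₂ _ (by ring) (congrArg₂ _
        (Finset.sum_congr rfl fun j _ => ?_) (Finset.sum_congr rfl fun μ _ => by ring))
      split_ifs with hij
      · subst hij
        ring
      · ring
    · exact Finset.sum_congr rfl fun μ _ => congrArg₂ _ (by ring) (congrArg₂ _
        (Finset.sum_congr rfl fun i _ => by ring) (Finset.sum_congr rfl fun ν _ => by ring))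
  · simp only [Finset.sum_add_distrib, Finset.sum_sub_distrib, ← Finset.mul_sum, ← Finset.sum_mul,
      Finset.sum_ite_eq', Finset.mem_univ, if_true]
    rw [Finset.sum_comm (f := fun i j => H j i ^ 2),
      Finset.sum_comm (f := fun i j => ξ.1 j * p i * H j i),
      Finset.sum_comm (f := fun μ i => M i μ ^ 2),
      Finset.sum_comm (f := fun μ i => ξ.1 i * q μ * M i μ),
      Finset.sum_comm (f := fun μ ν => N ν μ ^ 2)]
    ring

end Grushin

/-- Lower bound for `Γ₂` featuring the full Hessian terms:
`Γ₂(f) ≥ ¾ a²|D_x²f|² + ab|D_{xy}²f|² + ¾ b²|D_y²f|² − (C/|x|^{2−2α}) Γ(f)`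
with `a = |x|^{2α}`, `b = |x|^{2β}`. -/
theorem carre2_hessian_lower_bound (n m : ℕ) (hn : 1 ≤ n) (hm : 1 ≤ m)
    (α β : ℝ) (hα : α ∈ Set.Ioo (0 : ℝ) 1) (hβ : 0 ≤ β) :
    ∃ C : ℝ, 0 < C ∧
      ∀ f : EuclideanSpace ℝ (Fin n) × EuclideanSpace ℝ (Fin m) → ℝ,
        ContDiffOn ℝ (⊤ : ℕ∞) f {ξ : EuclideanSpace ℝ (Fin n) × EuclideanSpace ℝ (Fin m) | ξ.1 ≠ 0} →
        ∀ ξ : EuclideanSpace ℝ (Fin n) × EuclideanSpace ℝ (Fin m), ξ.1 ≠ 0 →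
          carre2 n m α β f ξ ≥
            3 / 4 * (‖ξ.1‖ ^ (2 * α)) ^ 2 *
                (∑ i, ∑ j, (pderiv' (eX n m i) (pderiv' (eX n m j) f) ξ) ^ 2)
              + ‖ξ.1‖ ^ (2 * α) * ‖ξ.1‖ ^ (2 * β) *
                (∑ i, ∑ μ, (pderiv' (eX n m i) (pderiv' (eY n m μ) f) ξ) ^ 2)
              + 3 / 4 * (‖ξ.1‖ ^ (2 * β)) ^ 2 *
                (∑ μ, ∑ ν, (pderiv' (eY n m μ) (pderiv' (eY n m ν) f) ξ) ^ 2)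
              - C / ‖ξ.1‖ ^ (2 - 2 * α) * carre n m α β f f ξ := by
  obtain ⟨hα0, hα1⟩ := hα
  refine ⟨1 + |α * (4 * α - 2 + n)| + 2 * α + 32 * α ^ 2 + 8 * n * α ^ 2 + 4 * m * β ^ 2
    + |β * (2 * β - 2 + n + 2 * α)| + 4 * β ^ 2, by positivity, fun f hf ξ hξ => ?_⟩
  have h0 : 0 < ‖ξ.1‖ := norm_pos_iff.2 hξ
  have ha : ‖ξ.1‖ ^ (2 * α) = ‖ξ.1‖ ^ (2 * α - 2) * ‖ξ.1‖ ^ 2 := by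
    rw [← Real.rpow_natCast, ← Real.rpow_add h0]; norm_num
  have hΓ : carre n m α β f f ξ = ‖ξ.1‖ ^ (2 * α - 2) * ‖ξ.1‖ ^ 2
      * ∑ i, pderiv' (eX n m i) f ξ ^ 2
      + ‖ξ.1‖ ^ (2 * β) * ∑ μ, pderiv' (eY n m μ) f ξ ^ 2 := by
    rw [carre_eq_sum α β hf hf hξ, Fintype.sum_sum_type, ← ha, Finset.mul_sum, Finset.mul_sum]
    simp only [pow_two]
    rfl
  have hdiv (C : ℝ) : C / ‖ξ.1‖ ^ (2 - 2 * α) = C * ‖ξ.1‖ ^ (2 * α - 2) := by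
    rw [← neg_sub (2 * α) 2, Real.rpow_neg h0.le, div_inv_eq_mul]
  rw [carre2_eq_sum α β hf hξ rfl rfl rfl rfl rfl rfl rfl rfl, hΓ, hdiv, ha]
  exact carre2_sums_lower_bound hα0 hα1 (by positivity) (by positivity)
    (inv_mul_cancel₀ (pow_pos h0 2).ne') (by positivity) _ _ _ _ _ _
    (EuclideanSpace.real_norm_sq_eq _).symm
end

section
/- Let n, m ≥ 1, α ∈ (0,1), β ≥ 0. There exist constants 0 < c₃ < c₄, depending only on n, m, α, β, such that for every r > 0, every y ∈ ℝᵐ, and every η = (x',y') ∈ ℝⁿ × ℝᵐ: (i) if |x'| ≤ c₃ r and |y − y'| ≤ c₃ r^{β+1−α}, then D((0,y), η) ≤ r^{1−α}; and (ii) if D((0,y), η) ≤ r^{1−α}, then |x'| ≤ c₄ r and |y − y'| ≤ c₄ r^{β+1−α}. -/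
/-- The quasi-distance
`D(ξ,η) = |x−x'|/(|x|+|x'|)^α + |y−y'|/((|x|+|x'|)^β + |y−y'|^{β/(β+1−α)})`
on `ℝⁿ × ℝᵐ`. -/
noncomputable def quasiD (n m : ℕ) (α β : ℝ)
    (ξ η : EuclideanSpace ℝ (Fin n) × EuclideanSpace ℝ (Fin m)) : ℝ :=
  ‖ξ.1 - η.1‖ / (‖ξ.1‖ + ‖η.1‖) ^ α
    + ‖ξ.2 - η.2‖ / ((‖ξ.1‖ + ‖η.1‖) ^ β + ‖ξ.2 - η.2‖ ^ (β / (β + 1 - α)))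

theorem div_rpow_eq_rpow_one_sub {a p : ℝ} (ha : 0 ≤ a) (hp : p < 1) :
    a / a ^ p = a ^ (1 - p) := by
  rcases ha.eq_or_lt with rfl | ha
  · rw [zero_div, Real.zero_rpow (by linarith)]
  · rw [Real.rpow_sub ha, Real.rpow_one]

theorem one_sub_div_add {β γ : ℝ} (hβ : 0 ≤ β) (hγ : 0 < γ) :
    1 - β / (β + γ) = γ / (β + γ) := by
  have : β + γ ≠ 0 := by positivity
  field_simp
  ring

theorem half_rpow_le_half {p : ℝ} (hp : 1 ≤ p) : (1 / 2 : ℝ) ^ p ≤ 1 / 2 := by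
  simpa using Real.rpow_le_rpow_of_exponent_ge (by norm_num : (0 : ℝ) < 1 / 2)
    (by norm_num) hp

theorem div_rpow_add_rpow_le {a b β γ : ℝ} (ha : 0 ≤ a) (hb : 0 ≤ b) (hβ : 0 ≤ β)
    (hγ : 0 < γ) : b / (a ^ β + b ^ (β / (β + γ))) ≤ b ^ (γ / (β + γ)) := by
  have hs : 0 < β + γ := by positivity
  rw [← one_sub_div_add hβ hγ,
    ← div_rpow_eq_rpow_one_sub hb ((div_lt_one hs).2 (by linarith))]
  rcases hb.eq_or_lt with rfl | hb
  · simp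
  · have := Real.rpow_nonneg ha β
    have := Real.rpow_pos_of_pos hb (β / (β + γ))
    gcongr
    linarith

theorem rpow_add_div_le_rpow {a b r β γ : ℝ} (ha : 0 ≤ a) (hb : 0 ≤ b) (hr : 0 < r)
    (hβ : 0 ≤ β) (hγ : 0 < γ)
    (har : a ≤ (1 / 2) ^ ((1 + (β + γ)) / γ) * r)
    (hbr : b ≤ (1 / 2) ^ ((1 + (β + γ)) / γ) * r ^ (β + γ)) :
    a ^ γ + b / (a ^ β + b ^ (β / (β + γ))) ≤ r ^ γ := by
  have hs : 0 < β + γ := by positivity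
  have hrγ := Real.rpow_pos_of_pos hr γ
  have h₁ : a ^ γ ≤ 1 / 2 * r ^ γ := by
    calc a ^ γ ≤ ((1 / 2) ^ ((1 + (β + γ)) / γ) * r) ^ γ := by gcongr
      _ = (1 / 2) ^ (1 + (β + γ)) * r ^ γ := by
        rw [Real.mul_rpow (by positivity) hr.le, ← Real.rpow_mul (by norm_num),
          div_mul_cancel₀ _ hγ.ne']
      _ ≤ 1 / 2 * r ^ γ := by
        gcongr
        exact half_rpow_le_half (by linarith)
  have h₂ : b ^ (γ / (β + γ)) ≤ 1 / 2 * r ^ γ := by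
    calc b ^ (γ / (β + γ))
        ≤ ((1 / 2) ^ ((1 + (β + γ)) / γ) * r ^ (β + γ)) ^ (γ / (β + γ)) := by gcongr
      _ = (1 / 2) ^ ((1 + (β + γ)) / (β + γ)) * r ^ γ := by
        rw [Real.mul_rpow (by positivity) (by positivity), ← Real.rpow_mul (by norm_num),
          ← Real.rpow_mul hr.le, div_mul_div_cancel₀ hγ.ne', mul_div_cancel₀ _ hs.ne']
      _ ≤ 1 / 2 * r ^ γ := by
        gcongr
        exact half_rpow_le_half ((one_le_div hs).2 (by linarith))
  linarith [div_rpow_add_rpow_le ha hb hβ hγ]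

theorem le_two_rpow_mul_rpow {a b r β γ : ℝ} (ha : 0 ≤ a) (hb : 0 ≤ b) (hr : 0 < r)
    (hβ : 0 ≤ β) (hγ : 0 < γ) (har : a ≤ r)
    (h : b / (a ^ β + b ^ (β / (β + γ))) ≤ r ^ γ) :
    b ≤ 2 ^ ((β + γ) / γ) * r ^ (β + γ) := by
  have hs : 0 < β + γ := by positivity
  rcases le_total b (r ^ (β + γ)) with hbr | hbr
  · have : (1 : ℝ) ≤ 2 ^ ((β + γ) / γ) := Real.one_le_rpow (by norm_num) (by positivity)
    have := Real.rpow_pos_of_pos hr (β + γ)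
    nlinarith
  · have hb : 0 < b := (Real.rpow_pos_of_pos hr _).trans_le hbr
    have hbp := Real.rpow_pos_of_pos hb (β / (β + γ))
    have haβ : a ^ β ≤ b ^ (β / (β + γ)) := by
      calc a ^ β ≤ r ^ β := by gcongr
        _ = (r ^ (β + γ)) ^ (β / (β + γ)) := by
          rw [← Real.rpow_mul hr.le, mul_div_cancel₀ _ hs.ne']
        _ ≤ b ^ (β / (β + γ)) := by gcongr
    have hle : b ≤ 2 * r ^ γ * b ^ (β / (β + γ)) := by
      rw [div_le_iff₀ (by positivity)] at h
      have := Real.rpow_pos_of_pos hr γ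
      nlinarith
    have hpow : b ^ (γ / (β + γ)) ≤ 2 * r ^ γ := by
      rwa [← one_sub_div_add hβ hγ,
        ← div_rpow_eq_rpow_one_sub hb.le ((div_lt_one hs).2 (by linarith)), div_le_iff₀ hbp]
    calc b = (b ^ (γ / (β + γ))) ^ ((β + γ) / γ) := by
          rw [← Real.rpow_mul hb.le, div_mul_div_cancel₀ hs.ne', div_self hγ.ne', Real.rpow_one]
      _ ≤ (2 * r ^ γ) ^ ((β + γ) / γ) := by gcongr
      _ = 2 ^ ((β + γ) / γ) * r ^ (β + γ) := by
        rw [Real.mul_rpow (by norm_num) (by positivity), ← Real.rpow_mul hr.le,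
          mul_div_cancel₀ _ hγ.ne']

theorem quasiD_zero_left {n m : ℕ} {α β : ℝ} (hα : α < 1) (y : EuclideanSpace ℝ (Fin m))
    (η : EuclideanSpace ℝ (Fin n) × EuclideanSpace ℝ (Fin m)) :
    quasiD n m α β (0, y) η = ‖η.1‖ ^ (1 - α) +
      ‖y - η.2‖ / (‖η.1‖ ^ β + ‖y - η.2‖ ^ (β / (β + (1 - α)))) := by
  simp [quasiD, div_rpow_eq_rpow_one_sub (norm_nonneg η.1) hα, add_sub_assoc]

/-- Ball comparison at the origin:
`B_n(0,c₃r) × B_m(y,c₃r^{β+1−α}) ⊆ B((0,y), r^{1−α}) ⊆ B_n(0,c₄r) × B_m(y,c₄r^{β+1−α})`,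
stated for the quasi-distance `D`. -/
theorem ball_at_origin (n m : ℕ) (hn : 1 ≤ n) (hm : 1 ≤ m)
    (α β : ℝ) (hα : α ∈ Set.Ioo (0 : ℝ) 1) (hβ : 0 ≤ β) :
    ∃ c₃ c₄ : ℝ, 0 < c₃ ∧ c₃ < c₄ ∧
      ∀ r : ℝ, 0 < r → ∀ y : EuclideanSpace ℝ (Fin m),
        ∀ η : EuclideanSpace ℝ (Fin n) × EuclideanSpace ℝ (Fin m),
          (‖η.1‖ ≤ c₃ * r ∧ ‖y - η.2‖ ≤ c₃ * r ^ (β + 1 - α) →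
            quasiD n m α β (0, y) η ≤ r ^ (1 - α)) ∧
          (quasiD n m α β (0, y) η ≤ r ^ (1 - α) →
            ‖η.1‖ ≤ c₄ * r ∧ ‖y - η.2‖ ≤ c₄ * r ^ (β + 1 - α)) := by
  have hγ : 0 < 1 - α := sub_pos.2 hα.2
  have hs : 0 < β + (1 - α) := by positivity
  have h_two : (1 : ℝ) < 2 ^ ((β + (1 - α)) / (1 - α)) :=
    Real.one_lt_rpow (by norm_num) (by positivity)
  have h_half : (1 / 2 : ℝ) ^ ((1 + (β + (1 - α))) / (1 - α)) < 1 :=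
    Real.rpow_lt_one (by norm_num) (by norm_num) (by positivity)
  refine ⟨(1 / 2) ^ ((1 + (β + (1 - α))) / (1 - α)), 2 ^ ((β + (1 - α)) / (1 - α)),
    by positivity, h_half.trans h_two, fun r hr y η => ?_⟩
  rw [quasiD_zero_left hα.2, add_sub_assoc]
  refine ⟨fun ⟨hx, hy⟩ =>
    rpow_add_div_le_rpow (norm_nonneg _) (norm_nonneg _) hr hβ hγ hx hy, fun h => ?_⟩
  have hfst : 0 ≤ ‖η.1‖ ^ (1 - α) := by positivity
  have hsnd : 0 ≤ ‖y - η.2‖ / (‖η.1‖ ^ β + ‖y - η.2‖ ^ (β / (β + (1 - α)))) := by positivity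
  have hx : ‖η.1‖ ≤ r :=
    (Real.rpow_le_rpow_iff (norm_nonneg _) hr.le hγ).1 (by linarith)
  exact ⟨hx.trans (le_mul_of_one_le_left hr.le h_two.le),
    le_two_rpow_mul_rpow (norm_nonneg _) (norm_nonneg _) hr hβ hγ hx (by linarith)⟩
end

section
/- Let m ≥ 1, α ∈ (0,1), β > 0, and c > 0. There exists a constant C > 0 depending only on m, α, β, c such that for all s > 0 and σ > 0, ∫₀^∞ exp( − c r² / ( s (σ + r^{2β/(β+1−α)}) ) ) r^{m−1} dr ≤ C max( s^{m/2} σ^{m/2}, s^{m(β+1−α)/(2(1−α))} ). -/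
open MeasureTheory

/-- A scaling form of the Gamma-type integral `∫₀^∞ r^q exp(-(k/t) r^p) dr`. -/
theorem exists_integral_rpow_mul_exp_neg_div_mul_rpow {p q k : ℝ} (hp : 0 < p) (hq : -1 < q)
    (hk : 0 < k) :
    ∃ K : ℝ, 0 < K ∧ ∀ t : ℝ, 0 < t →
      IntegrableOn (fun r : ℝ => r ^ q * Real.exp (-(k / t) * r ^ p)) (Set.Ioi 0) ∧
      ∫ r in Set.Ioi (0 : ℝ), r ^ q * Real.exp (-(k / t) * r ^ p) = K * t ^ ((q + 1) / p) := by
  have hq' : 0 < (q + 1) / p := div_pos (by linarith) hp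
  have hK : 0 < k ^ (-(q + 1) / p) * (1 / p) * Real.Gamma ((q + 1) / p) := by
    have := Real.Gamma_pos_of_pos hq'
    positivity
  refine ⟨_, hK, fun t ht => ?_⟩
  refine ⟨integrableOn_rpow_mul_exp_neg_mul_rpow hq hp (div_pos hk ht), ?_⟩
  rw [integral_rpow_mul_exp_neg_mul_rpow hp hq (div_pos hk ht), Real.div_rpow hk.le ht.le,
    neg_div, Real.rpow_neg ht.le ((q + 1) / p), div_inv_eq_mul]
  ring

/-- The exponential of a quotient with a sum in the denominator is at most the sum of the
exponentials with each summand, doubled, as denominator. -/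
theorem exp_neg_div_add_le {a x y : ℝ} (ha : 0 ≤ a) (hx : 0 < x) (hy : 0 < y) :
    Real.exp (-a / (x + y)) ≤ Real.exp (-a / (2 * x)) + Real.exp (-a / (2 * y)) := by
  rcases le_total x y with h | h
  · have : Real.exp (-a / (x + y)) ≤ Real.exp (-a / (2 * y)) := by
      rw [Real.exp_le_exp, neg_div, neg_div, neg_le_neg_iff]
      gcongr
      linarith
    linarith [Real.exp_pos (-a / (2 * x))]
  · have : Real.exp (-a / (x + y)) ≤ Real.exp (-a / (2 * x)) := by
      rw [Real.exp_le_exp, neg_div, neg_div, neg_le_neg_iff]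
      gcongr
      linarith
    linarith [Real.exp_pos (-a / (2 * y))]

/-- Gaussian-type integral estimate:
`∫₀^∞ exp(−c r²/(s(σ + r^{2β/(β+1−α)}))) r^{m−1} dr ≤ C max(s^{m/2}σ^{m/2}, s^{m(β+1−α)/(2(1−α))})`. -/
theorem gaussian_tail_integral (m : ℕ) (hm : 1 ≤ m) (α β c : ℝ)
    (hα : α ∈ Set.Ioo (0 : ℝ) 1) (hβ : 0 < β) (hc : 0 < c) :
    ∃ C : ℝ, 0 < C ∧
      ∀ s : ℝ, 0 < s → ∀ σ : ℝ, 0 < σ →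
        (∫ r in Set.Ioi (0 : ℝ),
            Real.exp (-(c * r ^ 2) / (s * (σ + r ^ (2 * β / (β + 1 - α))))) *
              r ^ ((m : ℝ) - 1))
          ≤ C * max (s ^ ((m : ℝ) / 2) * σ ^ ((m : ℝ) / 2))
              (s ^ ((m : ℝ) * (β + 1 - α) / (2 * (1 - α)))) := by
  have hα1 : 0 < 1 - α := sub_pos.2 hα.2
  have hD : 0 < β + 1 - α := by linarith
  have hm' : (1 : ℝ) ≤ m := by exact_mod_cast hm
  have hp : 0 < 2 * (1 - α) / (β + 1 - α) := by positivity
  have hq : (-1 : ℝ) < (m : ℝ) - 1 := by linarith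
  obtain ⟨K₁, hK₁, h₁⟩ :=
    exists_integral_rpow_mul_exp_neg_div_mul_rpow two_pos hq (half_pos hc)
  obtain ⟨K₂, hK₂, h₂⟩ :=
    exists_integral_rpow_mul_exp_neg_div_mul_rpow hp hq (half_pos hc)
  refine ⟨K₁ + K₂, by positivity, fun s hs σ hσ => ?_⟩
  obtain ⟨i₁, e₁⟩ := h₁ (s * σ) (mul_pos hs hσ)
  obtain ⟨i₂, e₂⟩ := h₂ s hs
  rw [sub_add_cancel, Real.mul_rpow hs.le hσ.le] at e₁
  rw [sub_add_cancel, div_div_eq_mul_div] at e₂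
  calc
    _ ≤ ∫ r in Set.Ioi (0 : ℝ), (r ^ ((m : ℝ) - 1) * Real.exp (-(c / 2 / (s * σ)) * r ^ (2 : ℝ)) +
          r ^ ((m : ℝ) - 1) *
            Real.exp (-(c / 2 / s) * r ^ (2 * (1 - α) / (β + 1 - α)))) := by
      refine integral_mono_of_nonneg ?_ (i₁.add i₂) ?_
      · filter_upwards [ae_restrict_mem measurableSet_Ioi] with r hr
        have hr : 0 < r := hr
        simp only [Pi.zero_apply]
        positivity
      · filter_upwards [ae_restrict_mem measurableSet_Ioi] with r hr
        have hr : 0 < r := hr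
        have hrγ : 0 < r ^ (2 * β / (β + 1 - α)) := Real.rpow_pos_of_pos hr _
        have hsq : r ^ 2 =
            r ^ (2 * (1 - α) / (β + 1 - α)) * r ^ (2 * β / (β + 1 - α)) := by
          rw [← Real.rpow_add hr, ← add_div, ← Real.rpow_natCast]
          congr 1
          push_cast
          field_simp
          ring
        have key := exp_neg_div_add_le (a := c * r ^ 2) (by positivity) (mul_pos hs hσ)
          (mul_pos hs hrγ)
        have ex : -(c * r ^ 2) / (2 * (s * σ)) = -(c / 2 / (s * σ)) * r ^ (2 : ℝ) := by
          rw [Real.rpow_two]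
          field_simp
        have ey : -(c * r ^ 2) / (2 * (s * r ^ (2 * β / (β + 1 - α)))) =
            -(c / 2 / s) * r ^ (2 * (1 - α) / (β + 1 - α)) := by
          rw [hsq]
          generalize r ^ (2 * β / (β + 1 - α)) = y at hrγ
          generalize r ^ (2 * (1 - α) / (β + 1 - α)) = z
          field_simp
        rw [ex, ey, ← mul_add] at key
        have := mul_le_mul_of_nonneg_right key (Real.rpow_nonneg hr.le ((m : ℝ) - 1))
        simp only [← mul_add]
        rwa [mul_comm (r ^ ((m : ℝ) - 1))]
    _ = K₁ * (s ^ ((m : ℝ) / 2) * σ ^ ((m : ℝ) / 2)) +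
          K₂ * s ^ ((m : ℝ) * (β + 1 - α) / (2 * (1 - α))) := by
      rw [integral_add i₁ i₂, e₁, e₂]
    _ ≤ _ := by
      rw [add_mul]
      gcongr
      · exact le_max_left _ _
      · exact le_max_right _ _
end

section
/- Let n, m ≥ 1, α ∈ (0,1), β ≥ 0, and set Q = (n + m(β+1−α))/(1−α). Let 1 ≤ p ≤ q < Q. If there exists a constant C_p > 0 such that (∫ |f|^{Qp/(Q−p)})^{(Q−p)/Q} ≤ C_p ∫ |∇_L f|^p for all f ∈ C_c^∞(ℝ^{n+m}), then there exists a constant C_q > 0 such that (∫ |f|^{Qq/(Q−q)})^{(Q−q)/Q} ≤ C_q ∫ |∇_L f|^q for all f ∈ C_c^∞(ℝ^{n+m}). (Self-improvement of the Sobolev inequalities (S_Q^p).) -/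
open MeasureTheory

/-- The pointwise norm of the Grushin gradient
`∇_L f = (|x|^α ∇_x f, |x|^β ∇_y f)` of `f : ℝⁿ × ℝᵐ → ℝ`,
i.e. `|∇_L f(x,y)|² = |x|^{2α} |∇_x f|² + |x|^{2β} |∇_y f|²`. -/
noncomputable def gradLNorm (n m : ℕ) (α β : ℝ)
    (f : EuclideanSpace ℝ (Fin n) × EuclideanSpace ℝ (Fin m) → ℝ)
    (ξ : EuclideanSpace ℝ (Fin n) × EuclideanSpace ℝ (Fin m)) : ℝ :=
  Real.sqrt (‖ξ.1‖ ^ (2 * α) * ‖gradient (fun x => f (x, ξ.2)) ξ.1‖ ^ 2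
    + ‖ξ.1‖ ^ (2 * β) * ‖gradient (fun y => f (ξ.1, y)) ξ.2‖ ^ 2)

/-- The homogeneous dimension `Q = (n + m(β+1−α))/(1−α)`. -/
noncomputable def homDim (n m : ℕ) (α β : ℝ) : ℝ :=
  (n + m * (β + 1 - α)) / (1 - α)

section

variable {n m : ℕ} {α β : ℝ}
  {f : EuclideanSpace ℝ (Fin n) × EuclideanSpace ℝ (Fin m) → ℝ}

theorem gradLNorm_eq_fderiv {ξ : EuclideanSpace ℝ (Fin n) × EuclideanSpace ℝ (Fin m)}
    (hf : DifferentiableAt ℝ f ξ) :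
    gradLNorm n m α β f ξ =
      Real.sqrt (‖ξ.1‖ ^ (2 * α) * ‖(fderiv ℝ f ξ).comp (.inl ℝ _ _)‖ ^ 2
        + ‖ξ.1‖ ^ (2 * β) * ‖(fderiv ℝ f ξ).comp (.inr ℝ _ _)‖ ^ 2) := by
  have h₁ : HasFDerivAt (fun x => f (x, ξ.2)) ((fderiv ℝ f ξ).comp (.inl ℝ _ _)) ξ.1 :=
    HasFDerivAt.comp (g := f) ξ.1 hf.hasFDerivAt (hasFDerivAt_prodMk_left ξ.1 ξ.2)
  have h₂ : HasFDerivAt (fun y => f (ξ.1, y)) ((fderiv ℝ f ξ).comp (.inr ℝ _ _)) ξ.2 :=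
    HasFDerivAt.comp (g := f) ξ.2 hf.hasFDerivAt (hasFDerivAt_prodMk_right ξ.1 ξ.2)
  simp only [gradLNorm, gradient, LinearIsometryEquiv.norm_map, h₁.fderiv, h₂.fderiv]

theorem gradLNorm_nonneg (ξ : EuclideanSpace ℝ (Fin n) × EuclideanSpace ℝ (Fin m)) :
    0 ≤ gradLNorm n m α β f ξ :=
  Real.sqrt_nonneg _

theorem gradLNorm_comp {φ : ℝ → ℝ} {φ' : ℝ}
    {ξ : EuclideanSpace ℝ (Fin n) × EuclideanSpace ℝ (Fin m)}
    (hφ : HasDerivAt φ φ' (f ξ)) (hf : DifferentiableAt ℝ f ξ) :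
    gradLNorm n m α β (fun ζ => φ (f ζ)) ξ = |φ'| * gradLNorm n m α β f ξ := by
  have h : HasFDerivAt (fun ζ => φ (f ζ)) (φ' • fderiv ℝ f ξ) ξ :=
    hφ.comp_hasFDerivAt ξ hf.hasFDerivAt
  rw [gradLNorm_eq_fderiv h.differentiableAt, gradLNorm_eq_fderiv hf, h.fderiv,
    ← Real.sqrt_sq_eq_abs, ← Real.sqrt_mul (sq_nonneg _)]
  simp only [ContinuousLinearMap.smul_comp, norm_smul, mul_pow, Real.norm_eq_abs, sq_abs]
  congr 1
  ring

theorem continuous_gradLNorm (hα : 0 ≤ α) (hβ : 0 ≤ β) (hf : ContDiff ℝ 1 f) :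
    Continuous (gradLNorm n m α β f) := by
  have hd : Continuous (fderiv ℝ f) := hf.continuous_fderiv one_ne_zero
  refine Continuous.congr ?_ fun ξ =>
    (gradLNorm_eq_fderiv (α := α) (β := β) (hf.differentiable one_ne_zero ξ)).symm
  refine Real.continuous_sqrt.comp (.add (.mul ?_ ?_) (.mul ?_ ?_))
  · exact continuous_fst.norm.rpow_const fun _ => .inr (by positivity)
  · exact ((hd.clm_comp continuous_const).norm).pow 2
  · exact continuous_fst.norm.rpow_const fun _ => .inr (by positivity)
  · exact ((hd.clm_comp continuous_const).norm).pow 2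

theorem gradLNorm_eq_zero_of_notMem_tsupport (hf : Differentiable ℝ f)
    {ξ : EuclideanSpace ℝ (Fin n) × EuclideanSpace ℝ (Fin m)} (hξ : ξ ∉ tsupport f) :
    gradLNorm n m α β f ξ = 0 := by
  have h : fderiv ℝ f ξ = 0 :=
    image_eq_zero_of_notMem_tsupport fun h => hξ (tsupport_fderiv_subset ℝ h)
  simp [gradLNorm_eq_fderiv (hf ξ), h]

end

/-- The smooth regularization `t ↦ (t² + ε²)^{γ/2} - |ε|^γ` of `t ↦ |t|^γ`. -/
noncomputable def regPow (γ ε t : ℝ) : ℝ :=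
  (t ^ 2 + ε ^ 2) ^ (γ / 2) - |ε| ^ γ

theorem sq_rpow_half (γ t : ℝ) : (t ^ 2) ^ (γ / 2) = |t| ^ γ := by
  rw [← sq_abs, ← Real.rpow_natCast, ← Real.rpow_mul (abs_nonneg t)]
  congr 1
  push_cast
  ring

theorem regPow_zero_right (γ ε : ℝ) : regPow γ ε 0 = 0 := by
  simp [regPow, sq_rpow_half]

theorem regPow_zero_left {γ : ℝ} (hγ : γ ≠ 0) (t : ℝ) : regPow γ 0 t = |t| ^ γ := by
  simp [regPow, sq_rpow_half, Real.zero_rpow hγ]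

theorem hasDerivAt_regPow (γ : ℝ) {ε : ℝ} (hε : ε ≠ 0) (t : ℝ) :
    HasDerivAt (regPow γ ε) (γ * t * (t ^ 2 + ε ^ 2) ^ (γ / 2 - 1)) t := by
  have hpos : t ^ 2 + ε ^ 2 ≠ 0 := by positivity
  have h : HasDerivAt (fun s : ℝ => s ^ 2 + ε ^ 2) (2 * t) t := by
    simpa using (hasDerivAt_pow 2 t).add_const (ε ^ 2)
  refine ((h.rpow_const (p := γ / 2) (.inl hpos)).sub_const (|ε| ^ γ)).congr_deriv ?_
  ring

theorem abs_deriv_regPow_le {γ ε : ℝ} (hγ : 0 ≤ γ) (hε : ε ≠ 0) (t : ℝ) :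
    |γ * t * (t ^ 2 + ε ^ 2) ^ (γ / 2 - 1)| ≤ γ * (t ^ 2 + ε ^ 2) ^ ((γ - 1) / 2) := by
  have hpos : 0 < t ^ 2 + ε ^ 2 := by positivity
  have ht : |t| ≤ (t ^ 2 + ε ^ 2) ^ (1 / 2 : ℝ) := by
    rw [← Real.sqrt_eq_rpow]
    exact Real.abs_le_sqrt (by nlinarith [sq_nonneg ε])
  rw [abs_mul, abs_mul, abs_of_nonneg hγ, abs_of_nonneg (Real.rpow_nonneg hpos.le _), mul_assoc]
  refine mul_le_mul_of_nonneg_left ?_ hγ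
  calc |t| * (t ^ 2 + ε ^ 2) ^ (γ / 2 - 1)
      ≤ (t ^ 2 + ε ^ 2) ^ (1 / 2 : ℝ) * (t ^ 2 + ε ^ 2) ^ (γ / 2 - 1) := by gcongr
    _ = (t ^ 2 + ε ^ 2) ^ ((γ - 1) / 2) := by
      rw [← Real.rpow_add hpos]
      ring_nf

theorem contDiff_regPow (γ : ℝ) {ε : ℝ} (hε : ε ≠ 0) {k : WithTop ℕ∞} :
    ContDiff ℝ k (regPow γ ε) := by
  refine ContDiff.sub (ContDiff.rpow_const_of_ne (by fun_prop) fun t => ?_) contDiff_const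
  positivity

theorem continuous_uncurry_regPow {γ : ℝ} (hγ : 0 ≤ γ) :
    Continuous fun z : ℝ × ℝ => regPow γ z.1 z.2 := by
  refine .sub (.rpow_const (by fun_prop) fun _ => .inr (by positivity)) ?_
  exact continuous_fst.abs.rpow_const fun _ => .inr hγ

/-- Applying a Sobolev inequality to (regularizations of) `|f|^γ`. -/
theorem sobolev_abs_rpow {n m : ℕ} {α β p r s C γ : ℝ} (hα : 0 ≤ α) (hβ : 0 ≤ β)
    (hp : 0 < p) (hr : 0 < r) (hs : 0 ≤ s) (hC : 0 ≤ C) (hγ : 1 ≤ γ)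
    (H : ∀ f : EuclideanSpace ℝ (Fin n) × EuclideanSpace ℝ (Fin m) → ℝ,
      ContDiff ℝ (⊤ : ℕ∞) f → HasCompactSupport f →
      (∫ ξ, |f ξ| ^ r) ^ s ≤ C * ∫ ξ, gradLNorm n m α β f ξ ^ p)
    {f : EuclideanSpace ℝ (Fin n) × EuclideanSpace ℝ (Fin m) → ℝ}
    (hf : ContDiff ℝ (⊤ : ℕ∞) f) (hc : HasCompactSupport f) :
    (∫ ξ, |f ξ| ^ (γ * r)) ^ s ≤
      C * γ ^ p * ∫ ξ, |f ξ| ^ ((γ - 1) * p) * gradLNorm n m α β f ξ ^ p := by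
  have hγ0 : 0 < γ := by linarith
  have hd : Differentiable ℝ f := hf.differentiable (by simp)
  have hG : Continuous (gradLNorm n m α β f) := continuous_gradLNorm hα hβ (hf.of_le (by simp))
  set K := tsupport f
  have hK : IsCompact K := hc
  have hG0 : ∀ ξ ∉ K, gradLNorm n m α β f ξ = 0 := fun ξ hξ =>
    gradLNorm_eq_zero_of_notMem_tsupport hd hξ
  have hf0 : ∀ ξ ∉ K, f ξ = 0 := fun ξ hξ => image_eq_zero_of_notMem_tsupport hξ
  let U : ℝ → ℝ := fun ε => (∫ ξ in K, |regPow γ ε (f ξ)| ^ r) ^ s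
  let V : ℝ → ℝ := fun ε => C * γ ^ p *
    ∫ ξ in K, (f ξ ^ 2 + ε ^ 2) ^ ((γ - 1) / 2 * p) * gradLNorm n m α β f ξ ^ p
  have hU : Continuous U := by
    refine (continuous_parametric_integral_of_continuous ?_ hK).rpow_const fun _ => .inr hs
    refine Continuous.rpow_const ?_ fun _ => .inr hr.le
    exact ((continuous_uncurry_regPow hγ0.le).comp
      (continuous_fst.prodMk (hf.continuous.comp continuous_snd))).abs
  have hV' : Continuous (fun z : ℝ × (EuclideanSpace ℝ (Fin n) × EuclideanSpace ℝ (Fin m)) =>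
      (f z.2 ^ 2 + z.1 ^ 2) ^ ((γ - 1) / 2 * p) * gradLNorm n m α β f z.2 ^ p) := by
    have := hf.continuous
    refine .mul (.rpow_const (by fun_prop) fun _ => .inr ?_)
      (.rpow_const (by fun_prop) fun _ => .inr hp.le)
    have : 0 ≤ γ - 1 := by linarith
    positivity
  have hV : Continuous V :=
    continuous_const.mul (continuous_parametric_integral_of_continuous hV' hK)
  have hUV : ∀ ε ≠ 0, U ε ≤ V ε := by
    intro ε hε
    let g := fun ξ => regPow γ ε (f ξ)
    have hg : ContDiff ℝ (⊤ : ℕ∞) g := (contDiff_regPow γ hε).comp hf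
    have hgc : HasCompactSupport g := hc.comp_left (regPow_zero_right γ ε)
    have hgG : ∀ ξ, gradLNorm n m α β g ξ =
        |γ * f ξ * (f ξ ^ 2 + ε ^ 2) ^ (γ / 2 - 1)| * gradLNorm n m α β f ξ := fun ξ =>
      gradLNorm_comp (hasDerivAt_regPow γ hε (f ξ)) (hd ξ)
    have hle : ∀ ξ, gradLNorm n m α β g ξ ^ p ≤
        γ ^ p * ((f ξ ^ 2 + ε ^ 2) ^ ((γ - 1) / 2 * p) * gradLNorm n m α β f ξ ^ p) := by
      intro ξ
      have hpos : 0 ≤ f ξ ^ 2 + ε ^ 2 := by positivity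
      rw [Real.rpow_mul hpos, ← mul_assoc, ← Real.mul_rpow hγ0.le (Real.rpow_nonneg hpos _),
        ← Real.mul_rpow (mul_nonneg hγ0.le (Real.rpow_nonneg hpos _)) (gradLNorm_nonneg ξ), hgG]
      exact Real.rpow_le_rpow (mul_nonneg (abs_nonneg _) (gradLNorm_nonneg ξ))
        (mul_le_mul_of_nonneg_right (abs_deriv_regPow_le hγ0.le hε _) (gradLNorm_nonneg ξ)) hp.le
    have hgcont : Continuous (gradLNorm n m α β g) :=
      continuous_gradLNorm hα hβ (hg.of_le (by simp))
    calc U ε = (∫ ξ, |g ξ| ^ r) ^ s := by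
          simp only [U, g]
          rw [setIntegral_eq_integral_of_forall_compl_eq_zero fun ξ hξ => by
            simp [hf0 ξ hξ, regPow_zero_right, Real.zero_rpow hr.ne']]
      _ ≤ C * ∫ ξ, gradLNorm n m α β g ξ ^ p := H g hg hgc
      _ = C * ∫ ξ in K, gradLNorm n m α β g ξ ^ p := by
          congr 1
          refine (setIntegral_eq_integral_of_forall_compl_eq_zero fun ξ hξ => ?_).symm
          simp [hgG, hG0 ξ hξ, Real.zero_rpow hp.ne']
      _ ≤ C * ∫ ξ in K,
          γ ^ p * ((f ξ ^ 2 + ε ^ 2) ^ ((γ - 1) / 2 * p) * gradLNorm n m α β f ξ ^ p) := by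
          refine mul_le_mul_of_nonneg_left (setIntegral_mono ?_ ?_ hle) hC
          · exact (hgcont.rpow_const fun _ => .inr hp.le).continuousOn.integrableOn_compact hK
          · exact (continuous_const.mul (hV'.comp (Continuous.prodMk_right ε))).continuousOn
              |>.integrableOn_compact hK
      _ = V ε := by rw [integral_const_mul, ← mul_assoc]
  have hlim : U 0 ≤ V 0 :=
    le_of_tendsto_of_tendsto (hU.continuousWithinAt (s := {0}ᶜ)) hV.continuousWithinAt
      (eventually_nhdsWithin_of_forall hUV)
  convert hlim using 1
  · simp only [U]
    congr 1
    rw [setIntegral_eq_integral_of_forall_compl_eq_zero fun ξ hξ => by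
      simp [hf0 ξ hξ, regPow_zero_right, Real.zero_rpow hr.ne']]
    refine integral_congr_ae (.of_forall fun ξ => ?_)
    simp only [regPow_zero_left hγ0.ne', abs_of_nonneg (Real.rpow_nonneg (abs_nonneg (f ξ)) γ),
      Real.rpow_mul (abs_nonneg (f ξ))]
  · simp only [V]
    congr 1
    rw [setIntegral_eq_integral_of_forall_compl_eq_zero fun ξ hξ => by
      simp [hG0 ξ hξ, Real.zero_rpow hp.ne']]
    refine integral_congr_ae (.of_forall fun ξ => ?_)
    have : (γ - 1) / 2 * p = (γ - 1) * p / 2 := by ring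
    simp [this, sq_rpow_half]

/-- Self-improvement of the Sobolev inequalities: `(S_Q^p) ⟹ (S_Q^q)` for
`1 ≤ p ≤ q < Q`. -/
theorem sobolev_self_improvement (n m : ℕ) (hn : 1 ≤ n) (hm : 1 ≤ m)
    (α β : ℝ) (hα : α ∈ Set.Ioo (0 : ℝ) 1) (hβ : 0 ≤ β)
    (p q : ℝ) (hp : 1 ≤ p) (hpq : p ≤ q) (hq : q < homDim n m α β)
    (C_p : ℝ) (hCp : 0 < C_p)
    (H : ∀ f : EuclideanSpace ℝ (Fin n) × EuclideanSpace ℝ (Fin m) → ℝ,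
      ContDiff ℝ (⊤ : ℕ∞) f → HasCompactSupport f →
      (∫ ξ, |f ξ| ^ (homDim n m α β * p / (homDim n m α β - p))) ^
          ((homDim n m α β - p) / homDim n m α β)
        ≤ C_p * ∫ ξ, gradLNorm n m α β f ξ ^ p) :
    ∃ C_q : ℝ, 0 < C_q ∧
      ∀ f : EuclideanSpace ℝ (Fin n) × EuclideanSpace ℝ (Fin m) → ℝ,
        ContDiff ℝ (⊤ : ℕ∞) f → HasCompactSupport f →
        (∫ ξ, |f ξ| ^ (homDim n m α β * q / (homDim n m α β - q))) ^
            ((homDim n m α β - q) / homDim n m α β)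
          ≤ C_q * ∫ ξ, gradLNorm n m α β f ξ ^ q := by
  rcases hpq.eq_or_lt with rfl | hlt
  · exact ⟨C_p, hCp, H⟩
  generalize homDim n m α β = Q at *
  have hp0 : 0 < p := by linarith
  have hq0 : 0 < q := by linarith
  have hQ0 : 0 < Q := by linarith
  have hQp : 0 < Q - p := by linarith
  have hQq : 0 < Q - q := by linarith
  have hqp : 0 < q - p := by linarith
  set γ := q * (Q - p) / (p * (Q - q)) with hγ_def
  set t := Q * q / (Q - q) with ht_def
  have hγ1 : γ - 1 = Q * (q - p) / (p * (Q - q)) := by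
    rw [hγ_def]
    field_simp
    ring
  have hγ : 0 < γ - 1 := by rw [hγ1]; positivity
  have hγr : γ * (Q * p / (Q - p)) = t := by
    rw [hγ_def, ht_def]
    field_simp
  have ht : 0 < t := by positivity
  have hγ0 : 0 < γ := by linarith
  have hD : 0 < C_p * γ ^ p := by positivity
  refine ⟨(C_p * γ ^ p) ^ (q / p), by positivity, fun f hf hc => ?_⟩
  set A := ∫ ξ, |f ξ| ^ t
  set B := ∫ ξ, gradLNorm n m α β f ξ ^ q
  have hA : 0 ≤ A := integral_nonneg fun ξ => by positivity
  have hB : 0 ≤ B := integral_nonneg fun ξ => Real.rpow_nonneg (gradLNorm_nonneg ξ) _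
  rcases hA.eq_or_lt with hA0 | hA0
  · rw [← hA0, Real.zero_rpow (by positivity)]
    positivity
  have hG : Continuous (gradLNorm n m α β f) :=
    continuous_gradLNorm hα.1.le hβ (hf.of_le (by simp))
  have hsob := sobolev_abs_rpow hα.1.le hβ hp0 (by positivity) (by positivity) hCp.le
    (by linarith : 1 ≤ γ) H hf hc
  rw [hγr] at hsob
  have hconj : (q / (q - p)).HolderConjugate (q / p) := by
    rw [Real.holderConjugate_iff]
    refine ⟨by rw [lt_div_iff₀ hqp]; linarith, ?_⟩
    field_simp
    ring
  have hholder := integral_mul_le_Lp_mul_Lq_of_nonneg (μ := volume) hconj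
    (f := fun ξ => |f ξ| ^ ((γ - 1) * p)) (g := fun ξ => gradLNorm n m α β f ξ ^ p)
    (.of_forall fun ξ => by positivity)
    (.of_forall fun ξ => Real.rpow_nonneg (gradLNorm_nonneg ξ) _)
    (Continuous.memLp_of_hasCompactSupport
      (hf.continuous.abs.rpow_const fun _ => .inr (by positivity))
      (hc.comp_left (g := fun x => |x| ^ ((γ - 1) * p))
        (by simp [Real.zero_rpow (mul_pos hγ hp0).ne'])))
    (Continuous.memLp_of_hasCompactSupport (hG.rpow_const fun _ => .inr hp0.le)
      (HasCompactSupport.intro hc fun ξ hξ => by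
        rw [gradLNorm_eq_zero_of_notMem_tsupport (hf.differentiable (by simp)) hξ,
          Real.zero_rpow hp0.ne']))
  have hA_eq : ∫ ξ, (|f ξ| ^ ((γ - 1) * p)) ^ (q / (q - p)) = A := by
    refine integral_congr_ae (.of_forall fun ξ => ?_)
    simp only [← Real.rpow_mul (abs_nonneg (f ξ))]
    congr 1
    rw [hγ1, ht_def]
    field_simp
  have hB_eq : ∫ ξ, (gradLNorm n m α β f ξ ^ p) ^ (q / p) = B := by
    refine integral_congr_ae (.of_forall fun ξ => ?_)
    simp only [← Real.rpow_mul (gradLNorm_nonneg ξ)]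
    congr 1
    field_simp
  rw [hA_eq, hB_eq, one_div_div, one_div_div] at hholder
  have hmain : A ^ ((Q - q) / Q * (p / q)) ≤ C_p * γ ^ p * B ^ (p / q) := by
    have hpow : 0 < A ^ ((q - p) / q) := Real.rpow_pos_of_pos hA0 _
    refine le_of_mul_le_mul_right ?_ hpow
    calc A ^ ((Q - q) / Q * (p / q)) * A ^ ((q - p) / q) = A ^ ((Q - p) / Q) := by
          rw [← Real.rpow_add hA0]
          congr 1
          field_simp
          ring
      _ ≤ _ := hsob
      _ ≤ C_p * γ ^ p * (A ^ ((q - p) / q) * B ^ (p / q)) :=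
          mul_le_mul_of_nonneg_left hholder hD.le
      _ = _ := by ring
  have hfin := Real.rpow_le_rpow (by positivity) hmain (by positivity : 0 ≤ q / p)
  rw [Real.mul_rpow hD.le (by positivity), ← Real.rpow_mul hA, ← Real.rpow_mul hB, mul_assoc,
    div_mul_div_cancel₀ hq0.ne', div_self hp0.ne', mul_one, Real.rpow_one] at hfin
  exact hfin
end
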